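/- arXiv:2604.14211 — 4 statements merged into one kernel-verified Lean document; each statement's English description precedes it below -/
import Mathlib

section
/- Let C = {0,1}^N be the discrete hypercube with the Hamming metric, and let m be the lazy random walk with m_x(x) = 1/2 and m_x(y) = 1/(2N) for each of the N neighbors y of x. Then for any pair of adjacent vertices x,y (differing in exactly one coordinate), W1(m_x, m_y) = 1 − 1/N, and hence the Ollivier–Ricci curvature satisfies Ric(x,y) = 1/N; moreover, the diameter of C equals N, so the bound diam C ≤ 2 sup_x J(x) / k of the L¹ Bonnet–Myers theorem is attained with equality. -/
namespace ORC

variable {V : Type*}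

/-- A coupling of two finitely supported probability distributions `μ` and `ν` on `V`:
a matrix `A : V × V → [0,1]` with finite support whose row sums are `μ` and column sums
are `ν`. -/
def IsCoupling (μ ν : V → ℝ) (A : V → V → ℝ) : Prop :=
  (∀ u v, 0 ≤ A u v ∧ A u v ≤ 1) ∧
  (Function.support fun p : V × V => A p.1 p.2).Finite ∧
  (∀ u, ∑ᶠ v, A u v = μ u) ∧
  (∀ v, ∑ᶠ u, A u v = ν v)

/-- The 1-Wasserstein distance between finitely supported distributions `μ`, `ν` with
respect to the distance `d`: the infimum over couplings `A` of `Σ A(u,v) d(u,v)`. -/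
noncomputable def W1 (d : V → V → ℝ) (μ ν : V → ℝ) : ℝ :=
  sInf {c | ∃ A : V → V → ℝ, IsCoupling μ ν A ∧ c = ∑ᶠ (u : V) (v : V), A u v * d u v}

end ORC

/-- The Hamming metric on the discrete hypercube `{0,1}^N`. -/
noncomputable def cubeDist (N : ℕ) (x y : Fin N → Bool) : ℝ := (hammingDist x y : ℝ)

/-- The lazy random walk on the hypercube: `m_x(x) = 1/2` and `m_x(y) = 1/(2N)` for each
of the `N` neighbors `y` of `x`. -/
noncomputable def cubeLazy (N : ℕ) (x : Fin N → Bool) : (Fin N → Bool) → ℝ := fun v =>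
  if v = x then 1 / 2 else if hammingDist x v = 1 then 1 / (2 * (N : ℝ)) else 0

/-- The Dirac mass at a vertex `x` of the hypercube. -/
noncomputable def cubeDirac (N : ℕ) (x : Fin N → Bool) : (Fin N → Bool) → ℝ := fun v =>
  if v = x then 1 else 0

/-- The jump `J(x) = W1(δ_x, m_x)` of the lazy random walk at `x`. -/
noncomputable def cubeJ (N : ℕ) (x : Fin N → Bool) : ℝ :=
  ORC.W1 (cubeDist N) (cubeDirac N x) (cubeLazy N x)

namespace ORC

/-- The distribution of `a k` when `k` is drawn with constant weight `c` from a finite type. -/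
noncomputable def constWeightLaw {V K : Type*} [DecidableEq V] [Fintype K] (c : ℝ) (a : K → V) :
    V → ℝ :=
  fun v => ∑ k, if v = a k then c else 0

section Kantorovich

variable {V K : Type*} [Fintype V]

/-- Kantorovich duality, easy direction: a coupling costs at least the difference of the means
of a function that is 1-Lipschitz for `d`. -/
lemma IsCoupling.sub_le_cost {d : V → V → ℝ} {μ ν : V → ℝ} {A : V → V → ℝ}
    (hA : IsCoupling μ ν A) {f : V → ℝ} (hf : ∀ u v, f u - f v ≤ d u v) :
    ∑ u, μ u * f u - ∑ v, ν v * f v ≤ ∑ᶠ (u : V) (v : V), A u v * d u v := by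
  obtain ⟨hpos, -, hμ, hν⟩ := hA
  simp only [finsum_eq_sum_of_fintype] at hμ hν ⊢
  calc ∑ u, μ u * f u - ∑ v, ν v * f v
      = ∑ u, ∑ v, A u v * (f u - f v) := by
        simp only [mul_sub, Finset.sum_sub_distrib, ← hμ, ← hν, Finset.sum_mul]
        rw [Finset.sum_comm (f := fun v u => A u v * f v)]
    _ ≤ ∑ u, ∑ v, A u v * d u v := by
        gcongr with u _ v _
        · exact (hpos u v).1
        · exact hf u v

variable [DecidableEq V] [Fintype K]

lemma sum_constWeightLaw_mul (c : ℝ) (a : K → V) (f : V → ℝ) :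
    ∑ v, constWeightLaw c a v * f v = ∑ k, c * f (a k) := by
  simp only [constWeightLaw, Finset.sum_mul]
  rw [Finset.sum_comm]
  simp

/-- The joint law of `(a k, b k)` couples the laws of `a` and `b`. -/
lemma isCoupling_joint {c : ℝ} (hc : 0 ≤ c) (hcK : Fintype.card K * c ≤ 1) (a b : K → V) :
    IsCoupling (constWeightLaw c a) (constWeightLaw c b)
      fun u v => ∑ k, if u = a k ∧ v = b k then c else 0 := by
  refine ⟨fun u v => ⟨Finset.sum_nonneg fun k _ => by split_ifs <;> simp [hc], ?_⟩,
    Set.toFinite _, fun u => ?_, fun v => ?_⟩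
  · calc (∑ k, if u = a k ∧ v = b k then c else 0) ≤ ∑ _k : K, c :=
          Finset.sum_le_sum fun k _ => by split_ifs <;> simp [hc]
      _ ≤ 1 := by simpa using hcK
  · rw [finsum_eq_sum_of_fintype, Finset.sum_comm]
    simp [constWeightLaw, ite_and, Finset.sum_ite_irrel]
  · rw [finsum_eq_sum_of_fintype, Finset.sum_comm]
    simp [constWeightLaw, ite_and]

lemma cost_joint (d : V → V → ℝ) (c : ℝ) (a b : K → V) :
    ∑ᶠ (u : V) (v : V), (∑ k, if u = a k ∧ v = b k then c else 0) * d u v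
      = ∑ k, c * d (a k) (b k) := by
  simp only [finsum_eq_sum_of_fintype, Finset.sum_mul]
  rw [Finset.sum_congr rfl fun u _ => Finset.sum_comm, Finset.sum_comm]
  simp [ite_and, Finset.sum_ite_irrel]

/-- If a 1-Lipschitz function realizes the distance along every pair `(a k, b k)`, then moving
`a k` to `b k` is an optimal transport plan. -/
lemma W1_constWeightLaw_eq {d : V → V → ℝ} {c : ℝ} (hc : 0 ≤ c)
    (hcK : Fintype.card K * c ≤ 1) {a b : K → V} (f : V → ℝ)
    (hf : ∀ u v, f u - f v ≤ d u v) (hab : ∀ k, f (a k) - f (b k) = d (a k) (b k)) :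
    W1 d (constWeightLaw c a) (constWeightLaw c b) = ∑ k, c * d (a k) (b k) := by
  refine IsLeast.csInf_eq ⟨⟨_, isCoupling_joint hc hcK a b, (cost_joint d c a b).symm⟩, ?_⟩
  rintro _ ⟨A, hA, rfl⟩
  have h := hA.sub_le_cost hf
  rw [sum_constWeightLaw_mul, sum_constWeightLaw_mul, ← Finset.sum_sub_distrib] at h
  simpa only [← mul_sub, hab] using h

end Kantorovich

end ORC

lemma eq_update_iff_eq_and {N : ℕ} (x v : Fin N → Bool) (j : Fin N) (b : Bool) :
    v = Function.update x j b ↔ b = v j ∧ ∀ k, k ≠ j → v k = x k := by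
  rw [Function.eq_update_iff, eq_comm]

/-- The lazy random walk resamples a uniformly chosen coordinate by a fair bit. -/
lemma cubeLazy_eq_constWeightLaw (N : ℕ) (hN : 0 < N) (x : Fin N → Bool) :
    cubeLazy N x = ORC.constWeightLaw (1 / (2 * (N : ℝ)))
      fun k : Fin N × Bool => Function.update x k.1 k.2 := by
  have hN' : (N : ℝ) ≠ 0 := by positivity
  funext v
  simp only [cubeLazy, ORC.constWeightLaw, Fintype.sum_prod_type, eq_update_iff_eq_and, ite_and,
    Finset.sum_ite_eq', Finset.mem_univ, if_true]
  by_cases hv : v = x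
  · subst hv
    simp
    field_simp
  rw [if_neg hv]
  split_ifs with h
  · obtain ⟨i, hi⟩ := Finset.card_eq_one.1 h
    have key : ∀ k, x k ≠ v k ↔ k = i := fun k => by simpa using Finset.ext_iff.1 hi k
    have hj : ∀ j, (∀ k, k ≠ j → v k = x k) ↔ j = i := by
      intro j
      grind
    simp [hj]
  · refine (Finset.sum_eq_zero fun j _ => if_neg fun hj => h ?_).symm
    refine Finset.card_eq_one.2 ⟨j, ?_⟩
    have : v j ≠ x j := fun e => hv (by funext k; grind)
    ext k
    simp
    grind

lemma cubeDirac_eq_constWeightLaw (N : ℕ) (hN : 0 < N) (x : Fin N → Bool) :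
    cubeDirac N x = ORC.constWeightLaw (1 / (2 * (N : ℝ))) fun _ : Fin N × Bool => x := by
  have hN' : (N : ℝ) ≠ 0 := by positivity
  funext v
  simp only [cubeDirac, ORC.constWeightLaw]
  split_ifs
  · simp
    field_simp
  · simp

lemma cubeDist_update (N : ℕ) (x : Fin N → Bool) (j : Fin N) (b : Bool) :
    cubeDist N x (Function.update x j b) = if b = x j then 0 else 1 := by
  split_ifs with h
  · simp [cubeDist, h]
  · have : hammingDist x (Function.update x j b) = 1 := by
      refine Finset.card_eq_one.2 ⟨j, ?_⟩
      ext k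
      by_cases hk : k = j
      · subst hk
        simpa using Ne.symm h
      · simp [hk]
    simp [cubeDist, this]

lemma card_mul_weight_le_one (N : ℕ) (hN : 0 < N) :
    (Fintype.card (Fin N × Bool) : ℝ) * (1 / (2 * (N : ℝ))) ≤ 1 := by
  have hN' : (N : ℝ) ≠ 0 := by positivity
  simp
  field_simp
  exact le_rfl

lemma cubeJ_eq (N : ℕ) (hN : 0 < N) (x : Fin N → Bool) : cubeJ N x = 1 / 2 := by
  have hN' : (N : ℝ) ≠ 0 := by positivity
  rw [cubeJ, cubeDirac_eq_constWeightLaw N hN, cubeLazy_eq_constWeightLaw N hN,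
    ORC.W1_constWeightLaw_eq (by positivity) (card_mul_weight_le_one N hN)
      fun z => -cubeDist N x z]
  · have hb : ∀ c : Bool, (∑ b : Bool, if b = c then (0 : ℝ) else 1) = 1 := by
      intro c
      cases c <;> simp
    simp only [cubeDist_update, Fintype.sum_prod_type, ← Finset.mul_sum, hb]
    simp
    field_simp
  · intro u v
    have : (hammingDist x v : ℝ) ≤ hammingDist x u + hammingDist u v := by
      exact_mod_cast hammingDist_triangle x u v
    simp only [cubeDist]
    linarith
  · intro k
    simp [cubeDist]

/-- Moving the lazy walk across the edge in direction `i`: the coupling that resamples the same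
coordinate by the same bit is optimal. -/
lemma W1_cubeLazy_adjacent (N : ℕ) (hN : 0 < N) (x y : Fin N → Bool) (h : hammingDist x y = 1) :
    ORC.W1 (cubeDist N) (cubeLazy N x) (cubeLazy N y) = 1 - 1 / (N : ℝ) := by
  have hN' : (N : ℝ) ≠ 0 := by positivity
  obtain ⟨i, hi⟩ := Finset.card_eq_one.1 h
  have key : ∀ k, x k ≠ y k ↔ k = i := fun k => by simpa using Finset.ext_iff.1 hi k
  have hdist : ∀ j b, cubeDist N (Function.update x j b) (Function.update y j b)
      = if j = i then 0 else 1 := by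
    intro j b
    split_ifs with hj
    · have : Function.update x j b = Function.update y j b := by
        funext k
        by_cases hk : k = j
        · simp [hk]
        · have := key k
          simp [hk]
          grind
      simp [cubeDist, this]
    · have : hammingDist (Function.update x j b) (Function.update y j b) = 1 := by
        refine Finset.card_eq_one.2 ⟨i, ?_⟩
        ext k
        have := key k
        by_cases hk : k = j
        · subst hk
          simp [hj]
        · simp [hk]
          grind
      simp [cubeDist, this]
  rw [cubeLazy_eq_constWeightLaw N hN, cubeLazy_eq_constWeightLaw N hN,
    ORC.W1_constWeightLaw_eq (by positivity) (card_mul_weight_le_one N hN)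
      fun z => if z i = x i then 1 else 0]
  · have hsum : (∑ j : Fin N, if j = i then (0 : ℝ) else 1) = N - 1 := by
      have : ∀ j : Fin N, (if j = i then (0 : ℝ) else 1) = 1 - if j = i then 1 else 0 := by
        intro j
        split_ifs <;> simp
      simp [this, Finset.sum_sub_distrib]
    simp only [hdist, Fintype.sum_prod_type_right, ← Finset.mul_sum, hsum]
    simp
    field_simp
  · intro u v
    by_cases huv : u = v
    · simp [huv, cubeDist]
    · have : (1 : ℝ) ≤ hammingDist u v := by
        exact_mod_cast hammingDist_pos.2 huv
      simp only [cubeDist]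
      split_ifs <;> linarith
  · rintro ⟨j, b⟩
    have hxy : y i ≠ x i := Ne.symm ((key i).2 rfl)
    rw [hdist]
    by_cases hj : j = i
    · subst hj
      simp
    · simp [hj, Ne.symm hj, hxy]

lemma isGreatest_cubeDist (N : ℕ) :
    IsGreatest {r : ℝ | ∃ x y : Fin N → Bool, r = cubeDist N x y} (N : ℝ) := by
  refine ⟨⟨fun _ => false, fun _ => true, ?_⟩, ?_⟩
  · simp [cubeDist, hammingDist]
  · rintro _ ⟨x, y, rfl⟩
    have h : hammingDist x y ≤ Fintype.card (Fin N) := hammingDist_le_card_fintype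
    rw [Fintype.card_fin] at h
    exact Nat.cast_le.2 h

/-- On the discrete hypercube `{0,1}^N` with the Hamming metric and the lazy random walk,
for adjacent vertices `x, y` one has `W1(m_x, m_y) = 1 - 1/N`, hence `Ric(x,y) = 1/N`;
moreover the diameter of the cube equals `N`, so the `L¹` Bonnet–Myers bound
`diam ≤ 2 sup_x J(x) / k` is attained with equality. -/
theorem hypercube_lazy_walk_curvature (N : ℕ) (hN : 0 < N) :
    (∀ x y : Fin N → Bool, hammingDist x y = 1 →
      ORC.W1 (cubeDist N) (cubeLazy N x) (cubeLazy N y) = 1 - 1 / (N : ℝ) ∧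
      1 - ORC.W1 (cubeDist N) (cubeLazy N x) (cubeLazy N y) / cubeDist N x y
        = 1 / (N : ℝ)) ∧
    IsGreatest {r : ℝ | ∃ x y : Fin N → Bool, r = cubeDist N x y} (N : ℝ) ∧
    (N : ℝ) = 2 * (⨆ x : Fin N → Bool, cubeJ N x) / (1 / (N : ℝ)) := by
  have hN' : (N : ℝ) ≠ 0 := by positivity
  refine ⟨fun x y h => ?_, isGreatest_cubeDist N, ?_⟩
  · rw [W1_cubeLazy_adjacent N hN x y h]
    simp [cubeDist, h]
  · simp only [cubeJ_eq N hN, ciSup_const]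
    field_simp
end

section
/- Let G be a locally finite connected graph and let x,y ∈ V(G) be distinct vertices. Then the function α ↦ Ric_α(x,y) is concave on [0,1]: for any 0 ≤ α < β < γ ≤ 1, writing λ = (γ − β)/(γ − α) (so that β = λα + (1−λ)γ), one has Ric_β(x,y) ≥ λ · Ric_α(x,y) + (1−λ) · Ric_γ(x,y). -/
namespace ORC

variable {V : Type*}

/-- The graph (shortest-path) distance, as a real number. -/
noncomputable def gdist (G : SimpleGraph V) : V → V → ℝ := fun u v => (G.dist u v : ℝ)

open scoped Classical in
/-- The Lin–Lu–Yau measure `m_x^α`: mass `α` at `x`, mass `(1-α)/d_x` at each neighbor of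
`x`, and `0` elsewhere. -/
noncomputable def mAlpha (G : SimpleGraph V) [∀ v, Fintype (G.neighborSet v)]
    (α : ℝ) (x : V) : V → ℝ := fun v =>
  if v = x then α else if G.Adj x v then (1 - α) / (G.degree x : ℝ) else 0

/-- The `α`-Ricci curvature `Ric_α(x,y) = 1 - W1(m_x^α, m_y^α)/d(x,y)`. -/
noncomputable def ricAlpha (G : SimpleGraph V) [∀ v, Fintype (G.neighborSet v)]
    (α : ℝ) (x y : V) : ℝ :=
  1 - W1 (gdist G) (mAlpha G α x) (mAlpha G α y) / gdist G x y

/-- A convex combination of couplings couples the convex combinations of the marginals. -/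
theorem IsCoupling.convexComb {μ ν μ' ν' : V → ℝ} {A C : V → V → ℝ} {s t : ℝ}
    (hA : IsCoupling μ ν A) (hC : IsCoupling μ' ν' C) (hs : 0 ≤ s) (ht : 0 ≤ t)
    (hst : s + t = 1) :
    IsCoupling (fun v => s * μ v + t * μ' v) (fun v => s * ν v + t * ν' v)
      (fun u v => s * A u v + t * C u v) := by
  obtain ⟨hA01, hAf, hArow, hAcol⟩ := hA
  obtain ⟨hC01, hCf, hCrow, hCcol⟩ := hC
  refine ⟨fun u v => ⟨?_, ?_⟩, ?_, fun u => ?_, fun v => ?_⟩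
  · have := (hA01 u v).1
    have := (hC01 u v).1
    positivity
  · nlinarith [(hA01 u v).2, (hC01 u v).2]
  · refine (hAf.union hCf).subset fun p hp => ?_
    contrapose! hp
    simp_all
  · have hA' : (Function.support (A u)).Finite :=
      hAf.preimage (f := fun v => (u, v)) (Prod.mk_right_injective u).injOn
    have hC' : (Function.support (C u)).Finite :=
      hCf.preimage (f := fun v => (u, v)) (Prod.mk_right_injective u).injOn
    rw [finsum_add_distrib (hA'.subset fun v hv => right_ne_zero_of_mul hv)
      (hC'.subset fun v hv => right_ne_zero_of_mul hv), ← mul_finsum,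
      ← mul_finsum, hArow, hCrow]
  · have hA' : (Function.support fun u => A u v).Finite :=
      hAf.preimage (f := fun u => (u, v)) (Prod.mk_left_injective v).injOn
    have hC' : (Function.support fun u => C u v).Finite :=
      hCf.preimage (f := fun u => (u, v)) (Prod.mk_left_injective v).injOn
    rw [finsum_add_distrib (hA'.subset fun v hv => right_ne_zero_of_mul hv)
      (hC'.subset fun v hv => right_ne_zero_of_mul hv), ← mul_finsum,
      ← mul_finsum, hAcol, hCcol]

/-- The transport cost is linear in the transport plan. -/
theorem cost_convexComb (d : V → V → ℝ) {A C : V → V → ℝ} (s t : ℝ)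
    (hA : (Function.support fun p : V × V => A p.1 p.2).Finite)
    (hC : (Function.support fun p : V × V => C p.1 p.2).Finite) :
    ∑ᶠ (u : V) (v : V), (s * A u v + t * C u v) * d u v =
      s * ∑ᶠ (u : V) (v : V), A u v * d u v + t * ∑ᶠ (u : V) (v : V), C u v * d u v := by
  have hA' : (Function.support fun p : V × V => A p.1 p.2 * d p.1 p.2).Finite :=
    hA.subset fun p hp => left_ne_zero_of_mul hp
  have hC' : (Function.support fun p : V × V => C p.1 p.2 * d p.1 p.2).Finite :=
    hC.subset fun p hp => left_ne_zero_of_mul hp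
  have hsA : (Function.support fun p : V × V => s * (A p.1 p.2 * d p.1 p.2)).Finite :=
    hA'.subset fun p hp => right_ne_zero_of_mul hp
  have htC : (Function.support fun p : V × V => t * (C p.1 p.2 * d p.1 p.2)).Finite :=
    hC'.subset fun p hp => right_ne_zero_of_mul hp
  have hsum : (Function.support fun p : V × V =>
      s * (A p.1 p.2 * d p.1 p.2) + t * (C p.1 p.2 * d p.1 p.2)).Finite :=
    (hsA.union htC).subset (Function.support_add _ _)
  simp only [add_mul, mul_assoc]
  rw [← finsum_curry _ hsum, ← finsum_curry _ hA', ← finsum_curry _ hC',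
    finsum_add_distrib hsA htC, ← mul_finsum, ← mul_finsum]

/-- The product of two finitely supported probability distributions is a coupling. -/
theorem IsCoupling.prod {μ ν : V → ℝ} (hμ : ∀ v, 0 ≤ μ v) (hν : ∀ v, 0 ≤ ν v)
    (hμf : (Function.support μ).Finite) (hνf : (Function.support ν).Finite)
    (hμ1 : ∑ᶠ v, μ v = 1) (hν1 : ∑ᶠ v, ν v = 1) :
    IsCoupling μ ν (fun u v => μ u * ν v) := by
  have hμle (u) : μ u ≤ 1 := hμ1 ▸ single_le_finsum u hμf hμ
  have hνle (u) : ν u ≤ 1 := hν1 ▸ single_le_finsum u hνf hν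
  refine ⟨fun u v => ⟨mul_nonneg (hμ u) (hν v), mul_le_one₀ (hμle u) (hν v) (hνle v)⟩, ?_,
    fun u => ?_, fun v => ?_⟩
  · exact (hμf.prod hνf).subset fun p hp => ⟨left_ne_zero_of_mul hp, right_ne_zero_of_mul hp⟩
  · rw [← mul_finsum, hν1, mul_one]
  · rw [← finsum_mul, hμ1, one_mul]

/-- The Wasserstein distance is jointly convex. -/
theorem W1_convexComb_le {d : V → V → ℝ} (hd : ∀ u v, 0 ≤ d u v) {μ ν μ' ν' : V → ℝ}
    (h : ∃ A, IsCoupling μ ν A) (h' : ∃ A, IsCoupling μ' ν' A) {s t : ℝ}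
    (hs : 0 ≤ s) (ht : 0 ≤ t) (hst : s + t = 1) :
    W1 d (fun v => s * μ v + t * μ' v) (fun v => s * ν v + t * ν' v) ≤
      s * W1 d μ ν + t * W1 d μ' ν' := by
  refine le_of_forall_pos_le_add fun ε hε => ?_
  obtain ⟨A₀, hA₀⟩ := h
  obtain ⟨C₀, hC₀⟩ := h'
  obtain ⟨_, ⟨A, hA, rfl⟩, ha⟩ :=
    exists_lt_of_csInf_lt (by exact ⟨_, A₀, hA₀, rfl⟩) (lt_add_of_pos_right (W1 d μ ν) hε)
  obtain ⟨_, ⟨C, hC, rfl⟩, hc⟩ :=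
    exists_lt_of_csInf_lt (by exact ⟨_, C₀, hC₀, rfl⟩) (lt_add_of_pos_right (W1 d μ' ν') hε)
  calc
    _ ≤ ∑ᶠ (u : V) (v : V), (s * A u v + t * C u v) * d u v := by
      refine csInf_le ⟨0, ?_⟩ ⟨_, hA.convexComb hC hs ht hst, rfl⟩
      rintro _ ⟨B, hB, rfl⟩
      exact finsum_nonneg fun u => finsum_nonneg fun v => mul_nonneg (hB.1 u v).1 (hd u v)
    _ = s * ∑ᶠ (u : V) (v : V), A u v * d u v + t * ∑ᶠ (u : V) (v : V), C u v * d u v :=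
      cost_convexComb d s t hA.2.1 hC.2.1
    _ ≤ s * (W1 d μ ν + ε) + t * (W1 d μ' ν' + ε) := by gcongr
    _ = _ := by linear_combination ε * hst

section mAlpha

variable (G : SimpleGraph V) [∀ v, Fintype (G.neighborSet v)]

theorem mAlpha_nonneg {α : ℝ} (h0 : 0 ≤ α) (h1 : α ≤ 1) (x v : V) : 0 ≤ mAlpha G α x v := by
  have : 0 ≤ 1 - α := sub_nonneg.2 h1
  unfold mAlpha
  split_ifs <;> positivity

open scoped Classical in
theorem support_mAlpha_subset (α : ℝ) (x : V) :
    Function.support (mAlpha G α x) ⊆ ↑(insert x (G.neighborFinset x)) := by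
  intro v hv
  contrapose! hv
  simp_all [mAlpha]

theorem finsum_mAlpha (α : ℝ) {x : V} (hx : 0 < G.degree x) : ∑ᶠ v, mAlpha G α x v = 1 := by
  classical
  rw [finsum_eq_sum_of_support_subset _ (support_mAlpha_subset G α x),
    Finset.sum_insert (by simp), Finset.sum_congr rfl
      (g := fun _ => (1 - α) / (G.degree x : ℝ)) fun v hv => ?_]
  · have : (G.degree x : ℝ) ≠ 0 := by positivity
    simp [mAlpha]
    field_simp
    ring
  · have hv : G.Adj x v := by simpa using hv
    simp [mAlpha, hv, hv.ne']

theorem exists_isCoupling_mAlpha {α : ℝ} (h0 : 0 ≤ α) (h1 : α ≤ 1) {x y : V}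
    (hx : 0 < G.degree x) (hy : 0 < G.degree y) :
    ∃ A, IsCoupling (mAlpha G α x) (mAlpha G α y) A :=
  ⟨_, .prod (mAlpha_nonneg G h0 h1 x) (mAlpha_nonneg G h0 h1 y)
    ((Finset.finite_toSet _).subset (support_mAlpha_subset G α x))
    ((Finset.finite_toSet _).subset (support_mAlpha_subset G α y))
    (finsum_mAlpha G α hx) (finsum_mAlpha G α hy)⟩

theorem mAlpha_convexComb (α γ : ℝ) {s t : ℝ} (hst : s + t = 1) (x : V) :
    mAlpha G (s * α + t * γ) x = fun v => s * mAlpha G α x v + t * mAlpha G γ x v := by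
  ext v
  unfold mAlpha
  split_ifs
  · rfl
  · rw [← hst]
    obtain rfl : t = 1 - s := by linarith
    ring
  · simp

end mAlpha

end ORC

open ORC

/-- Lin–Lu–Yau concavity: for distinct vertices `x, y` of a locally finite connected
graph, `α ↦ Ric_α(x,y)` is concave on `[0,1]`. -/
theorem ricAlpha_concave {V : Type*} (G : SimpleGraph V) [∀ v, Fintype (G.neighborSet v)]
    (hconn : G.Connected) (x y : V) (hxy : x ≠ y)
    (α β γ lam : ℝ) (hα : 0 ≤ α) (hαβ : α < β) (hβγ : β < γ) (hγ : γ ≤ 1)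
    (hlam : lam = (γ - β) / (γ - α)) :
    lam * ricAlpha G α x y + (1 - lam) * ricAlpha G γ x y ≤ ricAlpha G β x y := by
  have : Nontrivial V := ⟨x, y, hxy⟩
  have hαγ : 0 < γ - α := by linarith
  have hs : 0 ≤ lam := hlam ▸ div_nonneg (by linarith) hαγ.le
  have ht : 0 ≤ 1 - lam := by
    rw [hlam, sub_nonneg, div_le_one hαγ]
    linarith
  have hst : lam + (1 - lam) = 1 := by ring
  have hβ : β = lam * α + (1 - lam) * γ := by
    rw [hlam]
    field_simp
    ring
  have hdeg (v : V) : 0 < G.degree v := hconn.preconnected.degree_pos_of_nontrivial v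
  have hW : W1 (gdist G) (mAlpha G β x) (mAlpha G β y) ≤
      lam * W1 (gdist G) (mAlpha G α x) (mAlpha G α y) +
        (1 - lam) * W1 (gdist G) (mAlpha G γ x) (mAlpha G γ y) := by
    rw [hβ, mAlpha_convexComb G α γ hst, mAlpha_convexComb G α γ hst]
    exact W1_convexComb_le (fun u v => Nat.cast_nonneg _)
      (exists_isCoupling_mAlpha G hα (by linarith) (hdeg x) (hdeg y))
      (exists_isCoupling_mAlpha G (by linarith) hγ (hdeg x) (hdeg y)) hs ht hst
  have hdist : 0 ≤ gdist G x y := Nat.cast_nonneg _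
  have hdiv := div_le_div_of_nonneg_right hW hdist
  rw [add_div, mul_div_assoc, mul_div_assoc] at hdiv
  unfold ricAlpha
  linarith
end

section
/- Let G be a locally finite connected graph and let x,y ∈ V(G) be adjacent vertices with degrees d_x > 1 and d_y > 1. Then the Ollivier–Ricci curvature of the edge xy (with respect to the uniform nearest-neighbor measures) satisfies Ric(x,y) ≥ 2/d_x + 2/d_y − 2. -/
namespace ORC

variable {V : Type*}

open scoped Classical in
/-- The uniform nearest-neighbor measure `m_x`: mass `1/d_x` at each neighbor of `x` and
`0` elsewhere. -/
noncomputable def mUnif (G : SimpleGraph V) [∀ v, Fintype (G.neighborSet v)]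
    (x : V) : V → ℝ := fun v =>
  if G.Adj x v then 1 / (G.degree x : ℝ) else 0

/-- The Ollivier–Ricci curvature of an edge `xy` (so `d(x,y) = 1`) with respect to the
uniform nearest-neighbor measures: `Ric(x,y) = 1 - W1(m_x, m_y)`. -/
noncomputable def ricEdge (G : SimpleGraph V) [∀ v, Fintype (G.neighborSet v)]
    (x y : V) : ℝ :=
  1 - W1 (gdist G) (mUnif G x) (mUnif G y)

end ORC

namespace ORC

variable {V : Type*}

lemma isCoupling_of_sum_eq (S : Finset V) {μ ν : V → ℝ} {A : V → V → ℝ}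
    (hA : ∀ u v, 0 ≤ A u v) (hl : ∀ u v, u ∉ S → A u v = 0) (hr : ∀ u v, v ∉ S → A u v = 0)
    (hμ : ∀ u, ∑ v ∈ S, A u v = μ u) (hν : ∀ v, ∑ u ∈ S, A u v = ν v) (hμ1 : ∀ u, μ u ≤ 1) :
    IsCoupling μ ν A := by
  refine ⟨fun u v => ⟨hA u v, ?_⟩, ?_, fun u => ?_, fun v => ?_⟩
  · by_cases hv : v ∈ S
    · exact (Finset.single_le_sum (fun w _ => hA u w) hv).trans ((hμ u).trans_le (hμ1 u))
    · simp [hr u v hv]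
  · refine (S ×ˢ S).finite_toSet.subset fun p hp => ?_
    simp only [Finset.coe_product, Set.mem_prod, Finset.mem_coe]
    exact ⟨by_contra fun h => hp (hl _ _ h), by_contra fun h => hp (hr _ _ h)⟩
  · rw [← hμ u]
    exact finsum_eq_sum_of_support_subset _ fun v hv => by_contra fun h => hv (hr u v h)
  · rw [← hν v]
    exact finsum_eq_sum_of_support_subset _ fun u hu => by_contra fun h => hu (hl u v h)

lemma W1_le_sum (S : Finset V) {d : V → V → ℝ} (hd : ∀ u v, 0 ≤ d u v) {μ ν : V → ℝ}
    {A : V → V → ℝ} (hA : IsCoupling μ ν A) (hl : ∀ u v, u ∉ S → A u v = 0)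
    (hr : ∀ u v, v ∉ S → A u v = 0) :
    W1 d μ ν ≤ ∑ u ∈ S, ∑ v ∈ S, A u v * d u v := by
  refine csInf_le ⟨0, ?_⟩ ⟨A, hA, ?_⟩
  · rintro c ⟨B, hB, rfl⟩
    exact finsum_nonneg fun u => finsum_nonneg fun v => mul_nonneg (hB.1 u v).1 (hd u v)
  · have hrow (u : V) : ∑ᶠ v, A u v * d u v = ∑ v ∈ S, A u v * d u v :=
      finsum_eq_sum_of_support_subset _ fun v hv => by_contra fun h => hv (by
        simp [hr u v h])
    simp only [hrow]
    refine (finsum_eq_sum_of_support_subset _ fun u hu => by_contra fun h => hu ?_).symm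
    exact Finset.sum_eq_zero fun v _ => by simp [hl u v h]

/-- Transport between `a • α + p` and `b • β + q`, where `p` has mass `1 - a` and `q` has
mass `1 - b`: the part `a • α` goes to `q`, the part `b • β` is filled from `p`, and the
rest of `p` is spread proportionally over the rest of `q`. -/
lemma W1_le_of_decomposition (S : Finset V) {d : V → V → ℝ} (hd : ∀ u v, 0 ≤ d u v)
    {α β p q μ ν : V → ℝ} {a b k : ℝ} (ha : 0 ≤ a) (hb : 0 ≤ b) (ha1 : a < 1) (hb1 : b < 1)
    (hab : a + b ≤ 1)
    (hα : ∀ u, 0 ≤ α u) (hβ : ∀ u, 0 ≤ β u) (hp : ∀ u, 0 ≤ p u) (hq : ∀ u, 0 ≤ q u)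
    (hαS : ∀ u, u ∉ S → α u = 0) (hβS : ∀ u, u ∉ S → β u = 0)
    (hpS : ∀ u, u ∉ S → p u = 0) (hqS : ∀ u, u ∉ S → q u = 0)
    (hα1 : ∑ u ∈ S, α u = 1) (hβ1 : ∑ u ∈ S, β u = 1)
    (hp1 : ∑ u ∈ S, p u = 1 - a) (hq1 : ∑ u ∈ S, q u = 1 - b)
    (hμ : ∀ u, μ u = a * α u + p u) (hν : ∀ u, ν u = b * β u + q u) (hμ1 : ∀ u, μ u ≤ 1)
    (hdα : ∀ u v, α u * q v * d u v ≤ α u * q v) (hdβ : ∀ u v, p u * β v * d u v ≤ p u * β v)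
    (hdpq : ∀ u v, p u * q v * d u v ≤ k * (p u * q v)) :
    W1 d μ ν ≤ a + b + k * (1 - a - b) := by
  have ha' : 0 < 1 - a := by linarith
  have hb' : 0 < 1 - b := by linarith
  set s := a / (1 - b) with hs
  set t := b / (1 - a) with ht
  set r := (1 - a - b) / ((1 - a) * (1 - b)) with hr
  have hs0 : 0 ≤ s := by positivity
  have ht0 : 0 ≤ t := by positivity
  have hr0 : 0 ≤ r := div_nonneg (by linarith) (by positivity)
  have hsb : s * (1 - b) = a := by rw [hs]; field_simp
  have hta : t * (1 - a) = b := by rw [ht]; field_simp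
  have hra : r * (1 - a) = 1 - s := by rw [hr, hs]; field_simp; ring
  have hrb : r * (1 - b) = 1 - t := by rw [hr, ht]; field_simp
  let A : V → V → ℝ := fun u v => s * (α u * q v) + t * (p u * β v) + r * (p u * q v)
  have hA0 (u v : V) : 0 ≤ A u v := by
    have := hα u; have := hβ v; have := hp u; have := hq v
    positivity
  have hAl (u v : V) (hu : u ∉ S) : A u v = 0 := by simp [A, hαS u hu, hpS u hu]
  have hAr (u v : V) (hv : v ∉ S) : A u v = 0 := by simp [A, hβS v hv, hqS v hv]
  have hA : IsCoupling μ ν A := by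
    refine isCoupling_of_sum_eq S hA0 hAl hAr (fun u => ?_) (fun v => ?_) hμ1
    · simp only [A, Finset.sum_add_distrib, ← Finset.mul_sum, hq1, hβ1, hμ]
      linear_combination α u * hsb + p u * hrb
    · simp only [A, Finset.sum_add_distrib, ← Finset.mul_sum, ← Finset.sum_mul, hp1, hα1, hν]
      linear_combination β v * hta + q v * hra
  calc W1 d μ ν ≤ ∑ u ∈ S, ∑ v ∈ S, A u v * d u v := W1_le_sum S hd hA hAl hAr
    _ ≤ ∑ u ∈ S, ∑ v ∈ S,
        (s * (α u * q v) + t * (p u * β v) + r * (k * (p u * q v))) := by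
      gcongr with u _ v _
      have h1 := mul_le_mul_of_nonneg_left (hdα u v) hs0
      have h2 := mul_le_mul_of_nonneg_left (hdβ u v) ht0
      have h3 := mul_le_mul_of_nonneg_left (hdpq u v) hr0
      simp only [A]
      linarith
    _ = a + b + k * (1 - a - b) := by
      simp only [Finset.sum_add_distrib, ← Finset.mul_sum, ← Finset.sum_mul, hp1, hq1, hα1, hβ1]
      linear_combination (1 - k) * hsb + hta + k * (1 - b) * hra

section Graph

variable (G : SimpleGraph V) [∀ v, Fintype (G.neighborSet v)]

lemma mUnif_nonneg (x u : V) : 0 ≤ mUnif G x u := by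
  unfold mUnif; split_ifs <;> positivity

lemma mUnif_le_one (x u : V) : mUnif G x u ≤ 1 := by
  unfold mUnif
  split_ifs
  · rw [one_div]; exact Nat.cast_inv_le_one _
  · exact zero_le_one

lemma sum_mUnif {x : V} (hx : 0 < G.degree x) {S : Finset V} (hS : G.neighborFinset x ⊆ S) :
    ∑ u ∈ S, mUnif G x u = 1 := by
  rw [← Finset.sum_subset hS fun u _ hu => by
    simpa [mUnif] using fun h : G.Adj x u => absurd ((G.mem_neighborFinset x u).2 h) hu]
  rw [Finset.sum_congr rfl fun u hu =>
    show mUnif G x u = 1 / (G.degree x : ℝ) from if_pos ((G.mem_neighborFinset x u).1 hu)]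
  have : (G.degree x : ℝ) ≠ 0 := by positivity
  simp [this]

end Graph

end ORC

open ORC

/-- Lin–Yau lower bound: for adjacent vertices `x, y` with degrees `d_x, d_y > 1`,
`Ric(x,y) ≥ 2/d_x + 2/d_y - 2`. -/
theorem lin_yau_lower_bound {V : Type*} (G : SimpleGraph V)
    [∀ v, Fintype (G.neighborSet v)] (hconn : G.Connected) (x y : V) (hadj : G.Adj x y)
    (hdx : 1 < G.degree x) (hdy : 1 < G.degree y) :
    2 / (G.degree x : ℝ) + 2 / (G.degree y : ℝ) - 2 ≤ ricEdge G x y := by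
  classical
  set a : ℝ := 1 / (G.degree x : ℝ) with ha
  set b : ℝ := 1 / (G.degree y : ℝ) with hb
  have ha2 : a ≤ 1 / 2 := one_div_le_one_div_of_le two_pos (by exact_mod_cast hdx)
  have hb2 : b ≤ 1 / 2 := one_div_le_one_div_of_le two_pos (by exact_mod_cast hdy)
  have ha0 : 0 ≤ a := by positivity
  have hb0 : 0 ≤ b := by positivity
  set S := G.neighborFinset x ∪ G.neighborFinset y with hS
  have hxS : x ∈ S := by simp [hS, hadj.symm]
  have hyS : y ∈ S := by simp [hS, hadj]
  let δ : V → V → ℝ := fun w u => if u = w then 1 else 0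
  let p : V → ℝ := fun u => mUnif G x u - a * δ y u
  let q : V → ℝ := fun u => mUnif G y u - b * δ x u
  have hp (u : V) : p u = if G.Adj x u ∧ u ≠ y then a else 0 := by
    by_cases h : u = y
    · subst h; simp [p, δ, mUnif, hadj, ha]
    · simp [p, δ, mUnif, h, ha]
  have hq (u : V) : q u = if G.Adj y u ∧ u ≠ x then b else 0 := by
    by_cases h : u = x
    · subst h; simp [q, δ, mUnif, hadj.symm, hb]
    · simp [q, δ, mUnif, h, hb]
  have hδ (w u : V) : 0 ≤ δ w u := by simp only [δ]; split_ifs <;> norm_num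
  have hδS (w : V) (hw : w ∈ S) (u : V) (hu : u ∉ S) : δ w u = 0 :=
    if_neg (ne_of_mem_of_not_mem hw hu).symm
  have hδ1 (w : V) (hw : w ∈ S) : ∑ u ∈ S, δ w u = 1 := by simp [δ, hw]
  have hp0 (u : V) : 0 ≤ p u := by rw [hp]; split_ifs <;> simp [ha0]
  have hq0 (u : V) : 0 ≤ q u := by rw [hq]; split_ifs <;> simp [hb0]
  have hpadj {u : V} (h : p u ≠ 0) : G.Adj x u := by
    by_contra h'; exact h (by simp [hp, h'])
  have hqadj {u : V} (h : q u ≠ 0) : G.Adj y u := by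
    by_contra h'; exact h (by simp [hq, h'])
  have key : W1 (gdist G) (mUnif G x) (mUnif G y) ≤ a + b + 3 * (1 - a - b) := by
    refine W1_le_of_decomposition S (d := gdist G) (α := δ y) (β := δ x) (p := p) (q := q)
      (fun u v => Nat.cast_nonneg _) ha0 hb0 (by linarith) (by linarith) (by linarith)
      (hδ y) (hδ x) hp0 hq0 (hδS y hyS) (hδS x hxS)
      (fun u hu => by_contra fun h => hu (by simp [hS, hpadj h]))
      (fun u hu => by_contra fun h => hu (by simp [hS, hqadj h]))
      (hδ1 y hyS) (hδ1 x hxS) ?_ ?_ (fun u => by simp [p]) (fun u => by simp [q])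
      (mUnif_le_one G x) (fun u v => ?_) (fun u v => ?_) (fun u v => ?_)
    · simp only [p, Finset.sum_sub_distrib, ← Finset.mul_sum, hδ1 y hyS, mul_one]
      rw [sum_mUnif G (zero_lt_one.trans hdx) Finset.subset_union_left]
    · simp only [q, Finset.sum_sub_distrib, ← Finset.mul_sum, hδ1 x hxS, mul_one]
      rw [sum_mUnif G (zero_lt_one.trans hdy) Finset.subset_union_right]
    · by_cases hu : u = y
      · by_cases hv : q v = 0
        · simp [hv]
        · simp [gdist, hu, SimpleGraph.dist_eq_one_iff_adj.2 (hqadj hv)]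
      · simp [δ, hu]
    · by_cases hv : v = x
      · by_cases hu : p u = 0
        · simp [hu]
        · simp [gdist, hv, SimpleGraph.dist_eq_one_iff_adj.2 (hpadj hu).symm]
      · simp [δ, hv]
    · by_cases hu : p u = 0
      · simp [hu]
      by_cases hv : q v = 0
      · simp [hv]
      have h3 : G.dist u v ≤ 3 :=
        SimpleGraph.dist_le
          (.cons (hpadj hu).symm (.cons hadj (.cons (hqadj hv) .nil)))
      have h3' : gdist G u v ≤ 3 := by unfold gdist; exact_mod_cast h3
      rw [mul_comm]
      exact mul_le_mul_of_nonneg_right h3' (mul_nonneg (hp0 u) (hq0 v))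
  have hxa : 2 / (G.degree x : ℝ) = 2 * a := by rw [ha]; ring
  have hyb : 2 / (G.degree y : ℝ) = 2 * b := by rw [hb]; ring
  rw [ricEdge, hxa, hyb]
  linarith
end

section
/- Let G be a locally finite connected graph and let x,y ∈ V(G) be adjacent vertices with d_y ≤ d_x (so d_y = min{d_x, d_y}), and suppose 1 − 1/d_x − 1/d_y − #(x,y)/d_y ≥ 0, where #(x,y) is the number of common neighbors of x and y. Then W1(m_x, m_y) ≤ 3 − 2/d_x − 2/d_y − #(x,y)/d_y − 2·#(x,y)/d_x. -/
namespace ORC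

variable {V : Type*}

/-- A nonnegative plan carried by `S ×ˢ T` bounds the Wasserstein distance from above. -/
theorem W1_le_sum_of_plan {d : V → V → ℝ} (hd : ∀ u v, 0 ≤ d u v) {μ ν : V → ℝ}
    (S T : Finset V) (hμ : ∀ u, u ∉ S → μ u = 0) (hμ1 : ∀ u, μ u ≤ 1)
    (hν : ∀ v, v ∉ T → ν v = 0) {A : V → V → ℝ} (hA : ∀ u v, 0 ≤ A u v)
    (hS : ∀ u v, u ∉ S → A u v = 0) (hT : ∀ u v, v ∉ T → A u v = 0)
    (hrow : ∀ u ∈ S, ∑ v ∈ T, A u v = μ u) (hcol : ∀ v ∈ T, ∑ u ∈ S, A u v = ν v) :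
    W1 d μ ν ≤ ∑ u ∈ S, ∑ v ∈ T, A u v * d u v := by
  have hsum : ∀ u, ∑ᶠ v, A u v = ∑ v ∈ T, A u v := fun u =>
    finsum_eq_sum_of_support_subset _ fun v hv => by
      by_contra h
      exact hv (hT u v h)
  refine csInf_le ⟨0, ?_⟩ ⟨A, ⟨fun u v => ⟨hA u v, ?_⟩, ?_, fun u => ?_, fun v => ?_⟩, ?_⟩
  · rintro c ⟨B, hB, rfl⟩
    exact finsum_nonneg fun u => finsum_nonneg fun v => mul_nonneg (hB.1 u v).1 (hd u v)
  · by_cases hu : u ∈ S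
    · by_cases hv : v ∈ T
      · exact (Finset.single_le_sum (fun w _ => hA u w) hv).trans ((hrow u hu).trans_le (hμ1 u))
      · simp [hT u v hv]
    · simp [hS u v hu]
  · refine (S ×ˢ T).finite_toSet.subset fun p hp => ?_
    by_contra h
    simp only [Finset.coe_product, Set.mem_prod, Finset.mem_coe, not_and_or] at h
    exact hp (h.elim (hS _ _) (hT _ _))
  · rw [hsum]
    by_cases hu : u ∈ S
    · exact hrow u hu
    · simp [hS u _ hu, hμ u hu]
  · rw [finsum_eq_sum_of_support_subset (s := S)]
    · by_cases hv : v ∈ T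
      · exact hcol v hv
      · simp [hT _ v hv, hν v hv]
    · intro u hu
      by_contra h
      exact hu (hS u v h)
  · rw [finsum_eq_sum_of_support_subset (s := S)]
    · refine Finset.sum_congr rfl fun u _ => ?_
      rw [finsum_eq_sum_of_support_subset (s := T)]
      intro v hv
      by_contra h
      exact hv (by simp [hT u v h])
    · intro u hu
      by_contra h
      exact hu (by simp [hS u _ h])

variable [DecidableEq V] (G : SimpleGraph V) [∀ v, Fintype (G.neighborSet v)]

/-- The neighbors of `x`, other than `y`, that are not neighbors of `y`. -/
def exclusiveNeighbors (x y : V) : Finset V :=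
  (G.neighborFinset x \ G.neighborFinset y).erase y

/-- The mass of `m_y` at `v` not yet supplied after the common neighbors keep their `m_x`-mass
and the mass of `y` is spread over the exclusive neighbors of `y`. -/
noncomputable def residualDemand (x y v : V) : ℝ :=
  if v ∈ G.neighborFinset x then 1 / (G.degree y : ℝ) - 1 / (G.degree x : ℝ)
  else if v = x then 1 / (G.degree y : ℝ)
  else 1 / (G.degree y : ℝ)
    - 1 / ((G.degree x : ℝ) * ((exclusiveNeighbors G y x).card : ℝ))

/-- The Jost–Liu transport plan from `m_x` to `m_y`. -/
noncomputable def jostLiuPlan (x y u v : V) : ℝ :=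
  if u ∈ exclusiveNeighbors G x y then
    if v ∈ G.neighborFinset y then
      residualDemand G x y v / ((exclusiveNeighbors G x y).card : ℝ)
    else 0
  else if u = y then
    if v ∈ exclusiveNeighbors G y x then
      1 / ((G.degree x : ℝ) * ((exclusiveNeighbors G y x).card : ℝ))
    else 0
  else if u = v ∧ u ∈ G.neighborFinset x ∩ G.neighborFinset y then 1 / (G.degree x : ℝ)
  else 0

variable {G} {x y : V}

theorem mem_exclusiveNeighbors {u : V} :
    u ∈ exclusiveNeighbors G x y ↔ u ≠ y ∧ G.Adj x u ∧ ¬ G.Adj y u := by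
  simp [exclusiveNeighbors]

theorem sum_neighborFinset_of_adj {M : Type*} [AddCommMonoid M] (h : G.Adj x y) (f : V → M) :
    ∑ u ∈ G.neighborFinset x, f u =
      f y + (∑ u ∈ G.neighborFinset x ∩ G.neighborFinset y, f u
        + ∑ u ∈ exclusiveNeighbors G x y, f u) := by
  have hy : y ∈ G.neighborFinset x \ G.neighborFinset y := by simp [h]
  rw [← Finset.sum_inter_add_sum_sdiff (G.neighborFinset x) (G.neighborFinset y),
    ← Finset.add_sum_erase _ f hy, exclusiveNeighbors, add_left_comm]

theorem degree_eq_of_adj (h : G.Adj x y) :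
    (G.degree x : ℝ) = 1 + (((G.neighborFinset x ∩ G.neighborFinset y).card : ℝ)
      + ((exclusiveNeighbors G x y).card : ℝ)) := by
  simpa using sum_neighborFinset_of_adj h fun _ => (1 : ℝ)

theorem jostLiuPlan_of_mem_exclusive {u v : V} (hu : u ∈ exclusiveNeighbors G x y)
    (hv : v ∈ G.neighborFinset y) :
    jostLiuPlan G x y u v =
      residualDemand G x y v / ((exclusiveNeighbors G x y).card : ℝ) := by
  rw [jostLiuPlan, if_pos hu, if_pos hv]

theorem jostLiuPlan_self (v : V) :
    jostLiuPlan G x y y v = if v ∈ exclusiveNeighbors G y x then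
      1 / ((G.degree x : ℝ) * ((exclusiveNeighbors G y x).card : ℝ)) else 0 := by
  rw [jostLiuPlan, if_neg (by simp [mem_exclusiveNeighbors]), if_pos rfl]

theorem jostLiuPlan_of_mem_inter {u : V} (v : V)
    (hu : u ∈ G.neighborFinset x ∩ G.neighborFinset y) :
    jostLiuPlan G x y u v = if u = v then 1 / (G.degree x : ℝ) else 0 := by
  have hu' : G.Adj x u ∧ G.Adj y u := by simpa using hu
  rw [jostLiuPlan, if_neg (by simp [mem_exclusiveNeighbors, hu'.2]), if_neg hu'.2.ne']
  simp only [hu, and_true]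

theorem residualDemand_of_adj {v : V} (hv : G.Adj x v) :
    residualDemand G x y v = 1 / (G.degree y : ℝ) - 1 / (G.degree x : ℝ) := by
  simp [residualDemand, hv]

theorem residualDemand_self : residualDemand G x y x = 1 / (G.degree y : ℝ) := by
  simp [residualDemand]

theorem residualDemand_of_mem_exclusive {v : V} (hv : v ∈ exclusiveNeighbors G y x) :
    residualDemand G x y v = 1 / (G.degree y : ℝ)
      - 1 / ((G.degree x : ℝ) * ((exclusiveNeighbors G y x).card : ℝ)) := by
  rw [mem_exclusiveNeighbors] at hv
  simp [residualDemand, hv]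

/-- Sums against the residual demand, for a function constant on each part of the
neighborhood of `y`. -/
theorem sum_residualDemand_mul (h : G.Adj x y) {f : V → ℝ} {p q r : ℝ} (hx : f x = p)
    (hC : ∀ v ∈ G.neighborFinset y ∩ G.neighborFinset x, f v = q)
    (hY : ∀ v ∈ exclusiveNeighbors G y x, f v = r) :
    ∑ v ∈ G.neighborFinset y, residualDemand G x y v * f v =
      1 / (G.degree y : ℝ) * p
      + (((G.neighborFinset x ∩ G.neighborFinset y).card : ℝ)
          * ((1 / (G.degree y : ℝ) - 1 / (G.degree x : ℝ)) * q)
        + ((exclusiveNeighbors G y x).card : ℝ) * ((1 / (G.degree y : ℝ)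
          - 1 / ((G.degree x : ℝ) * ((exclusiveNeighbors G y x).card : ℝ))) * r)) := by
  rw [sum_neighborFinset_of_adj h.symm, residualDemand_self, hx,
    Finset.inter_comm (G.neighborFinset x)]
  congr 2
  · rw [← nsmul_eq_mul]
    refine Finset.sum_eq_card_nsmul fun v hv => ?_
    rw [residualDemand_of_adj (by simpa using (Finset.mem_inter.1 hv).2), hC v hv]
  · rw [← nsmul_eq_mul]
    refine Finset.sum_eq_card_nsmul fun v hv => ?_
    rw [residualDemand_of_mem_exclusive hv, hY v hv]

end ORC

open ORC

/-- Jost–Liu transport-plan estimate: for adjacent vertices `x, y` with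
`d_y = min{d_x, d_y}` and `1 - 1/d_x - 1/d_y - #(x,y)/d_y ≥ 0`, one has
`W1(m_x, m_y) ≤ 3 - 2/d_x - 2/d_y - #(x,y)/d_y - 2#(x,y)/d_x`. -/
theorem jost_liu_transport_estimate {V : Type*} [DecidableEq V] (G : SimpleGraph V)
    [∀ v, Fintype (G.neighborSet v)] (hconn : G.Connected) (x y : V) (hadj : G.Adj x y)
    (hdeg : G.degree y ≤ G.degree x)
    (hgap : 0 ≤ 1 - 1 / (G.degree x : ℝ) - 1 / (G.degree y : ℝ)
        - ((G.neighborFinset x ∩ G.neighborFinset y).card : ℝ) / (G.degree y : ℝ)) :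
    W1 (gdist G) (mUnif G x) (mUnif G y)
      ≤ 3 - 2 / (G.degree x : ℝ) - 2 / (G.degree y : ℝ)
        - ((G.neighborFinset x ∩ G.neighborFinset y).card : ℝ) / (G.degree y : ℝ)
        - 2 * ((G.neighborFinset x ∩ G.neighborFinset y).card : ℝ)
          / (G.degree x : ℝ) := by
  set t : ℝ := ((G.neighborFinset x ∩ G.neighborFinset y).card : ℝ) with ht
  set P : ℝ := ((exclusiveNeighbors G x y).card : ℝ) with hPdef
  set Q : ℝ := ((exclusiveNeighbors G y x).card : ℝ) with hQdef
  have ha : (G.degree x : ℝ) = 1 + (t + P) := degree_eq_of_adj hadj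
  have hb : (G.degree y : ℝ) = 1 + (t + Q) := by
    rw [degree_eq_of_adj hadj.symm, Finset.inter_comm]
  have hab : (G.degree y : ℝ) ≤ G.degree x := by exact_mod_cast hdeg
  have ht0 : 0 ≤ t := Nat.cast_nonneg _
  have hQ0 : 0 ≤ Q := Nat.cast_nonneg _
  have hresid := @residualDemand_of_mem_exclusive V _ G _ x y
  have hsumr := @sum_residualDemand_mul V _ G _ x y hadj
  have hself := @jostLiuPlan_self V _ G _ x y
  have hexcl := @jostLiuPlan_of_mem_exclusive V _ G _ x y
  have hinter := @jostLiuPlan_of_mem_inter V _ G _ x y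
  have hradj := @residualDemand_of_adj V _ G _ x y
  have hrself := @residualDemand_self V _ G _ x y
  simp only [← ht, ← hPdef, ← hQdef] at hresid hsumr hself hexcl
  have hmux : ∀ u, G.Adj x u → mUnif G x u = 1 / (G.degree x : ℝ) := fun u hu => if_pos hu
  have hmuy : ∀ u, G.Adj y u → mUnif G y u = 1 / (G.degree y : ℝ) := fun u hu => if_pos hu
  set a : ℝ := (G.degree x : ℝ)
  set b : ℝ := (G.degree y : ℝ)
  have hb0 : 0 < b := by linarith
  have ha0 : 0 < a := by linarith
  have hQb : 1 / a ≤ Q / b := by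
    have : Q / b = 1 - 1 / b - t / b := by field_simp; linarith
    linarith
  have hQ : 0 < Q := by
    have : 0 < Q / b := lt_of_lt_of_le (by positivity) hQb
    exact (div_pos_iff_of_pos_right hb0).1 this
  have hP : 0 < P := by linarith
  have hba : 1 / a ≤ 1 / b := one_div_le_one_div_of_le hb0 hab
  have hrY : 1 / (a * Q) ≤ 1 / b := by
    rw [div_le_div_iff₀ ha0 hb0] at hQb
    exact one_div_le_one_div_of_le hb0 (by linarith)
  have hr : ∀ v ∈ G.neighborFinset y, 0 ≤ residualDemand G x y v := by
    intro v hv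
    by_cases h1 : G.Adj x v
    · rw [hradj h1]; linarith
    by_cases h2 : v = x
    · rw [h2, hrself]; positivity
    rw [hresid (mem_exclusiveNeighbors.2 ⟨h2, by simpa using hv, h1⟩)]
    linarith
  have hA0 : ∀ u v, 0 ≤ jostLiuPlan G x y u v := by
    intro u v
    unfold jostLiuPlan
    split_ifs with h1 h2
    · exact div_nonneg (hr v h2) hP.le
    all_goals positivity
  have hYsub : G.neighborFinset y ∩ exclusiveNeighbors G y x = exclusiveNeighbors G y x :=
    Finset.inter_eq_right.2 fun v hv => by simpa using (mem_exclusiveNeighbors.1 hv).2.1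
  have hdist1 : ∀ {u v}, G.Adj u v → gdist G u v = 1 := fun h => by
    simp [gdist, SimpleGraph.dist_eq_one_iff_adj.2 h]
  have htri : ∀ u v w, gdist G u w ≤ gdist G u v + gdist G v w := fun u v w => by
    unfold gdist
    exact_mod_cast hconn.dist_triangle
  have hcost : ∑ u ∈ G.neighborFinset x, ∑ v ∈ G.neighborFinset y,
      jostLiuPlan G x y u v * gdist G u v ≤
      3 - 2 / a - 2 / b - t / b - 2 * t / a := by
    have hcosty : ∑ v ∈ G.neighborFinset y, jostLiuPlan G x y y v * gdist G y v = 1 / a := by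
      have : ∀ v ∈ G.neighborFinset y, jostLiuPlan G x y y v * gdist G y v =
          if v ∈ exclusiveNeighbors G y x then 1 / (a * Q) else 0 := fun v hv => by
        rw [hself, hdist1 (by simpa using hv), mul_one]
      rw [Finset.sum_congr rfl this, Finset.sum_ite_mem, hYsub, Finset.sum_const,
        nsmul_eq_mul, ← hQdef]
      field_simp
    have hcostC : ∀ u ∈ G.neighborFinset x ∩ G.neighborFinset y,
        ∑ v ∈ G.neighborFinset y, jostLiuPlan G x y u v * gdist G u v = 0 := fun u hu =>
      Finset.sum_eq_zero fun v _ => by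
        rw [hinter v hu]
        split_ifs with h
        · simp [h, gdist]
        · simp
    have hcostX : ∀ u ∈ exclusiveNeighbors G x y,
        ∑ v ∈ G.neighborFinset y, jostLiuPlan G x y u v * gdist G u v ≤
          (1 / b + (t * ((1 / b - 1 / a) * 2) + Q * ((1 / b - 1 / (a * Q)) * 3))) / P := by
      intro u hu
      have hux := (mem_exclusiveNeighbors.1 hu).2.1.symm
      have key := hsumr (f := fun v => if v ∈ G.neighborFinset x then 2 else if v = x then 1 else 3)
        (p := 1) (q := 2) (r := 3) (by simp)
        (fun v hv => if_pos (Finset.mem_inter.1 hv).2)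
        (fun v hv => by
          have := mem_exclusiveNeighbors.1 hv
          simp [this])
      rw [mul_one] at key
      rw [← key, Finset.sum_div]
      refine Finset.sum_le_sum fun v hv => ?_
      rw [hexcl hu hv, div_mul_eq_mul_div]
      refine div_le_div_of_nonneg_right (mul_le_mul_of_nonneg_left ?_ (hr v hv)) hP.le
      have hyv : G.Adj y v := by simpa using hv
      split_ifs with h1 h2
      · linarith [htri u x v, hdist1 hux, hdist1 ((G.mem_neighborFinset x v).1 h1)]
      · rw [h2, hdist1 hux]
      · linarith [htri u x v, htri x y v, hdist1 hux, hdist1 hadj, hdist1 hyv]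
    rw [sum_neighborFinset_of_adj hadj, hcosty, Finset.sum_eq_zero hcostC, zero_add]
    refine (add_le_add_right (Finset.sum_le_card_nsmul _ _ _ hcostX) _).trans_eq ?_
    rw [nsmul_eq_mul, ← hPdef, mul_div_cancel₀ _ hP.ne', show Q = b - 1 - t by linarith]
    have hQ' : b - 1 - t ≠ 0 := by linarith
    field_simp
    ring
  refine (W1_le_sum_of_plan (μ := mUnif G x) (ν := mUnif G y) (fun u v => Nat.cast_nonneg _)
    (G.neighborFinset x) (G.neighborFinset y) (fun u hu => if_neg (by simpa using hu)) (fun u => ?_)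
    (fun v hv => if_neg (by simpa using hv)) hA0 (fun u v hu => ?_) (fun u v hv => ?_)
    (fun u hu => ?_) (fun v hv => ?_)).trans hcost
  · by_cases hu : G.Adj x u
    · refine (hmux u hu).trans_le ?_
      rw [div_le_one ha0]
      linarith
    · simp [mUnif, hu]
  · have hu : ¬ G.Adj x u := by simpa using hu
    have hne : u ≠ y := by rintro rfl; exact hu hadj
    simp [jostLiuPlan, mem_exclusiveNeighbors, hu, hne]
  · have hv : ¬ G.Adj y v := by simpa using hv
    have hv' : v ∉ exclusiveNeighbors G y x := by simp [mem_exclusiveNeighbors, hv]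
    have hv'' : ¬ (u = v ∧ u ∈ G.neighborFinset x ∩ G.neighborFinset y) := by
      rintro ⟨rfl, h⟩
      exact hv (by simpa using (Finset.mem_inter.1 h).2)
    rw [jostLiuPlan, if_neg hv', if_neg hv'']
    simp [hv]
  · rw [hmux u (by simpa using hu)]
    by_cases h1 : u ∈ exclusiveNeighbors G x y
    · have := hsumr (f := fun _ => 1) rfl (fun _ _ => rfl) (fun _ _ => rfl)
      simp only [mul_one] at this
      rw [Finset.sum_congr rfl fun v hv => hexcl h1 hv, ← Finset.sum_div, this]
      field_simp
      linear_combination b * ha - a * hb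
    by_cases h2 : u = y
    · rw [h2, Finset.sum_congr rfl fun v _ => hself v, Finset.sum_ite_mem, hYsub,
        Finset.sum_const, nsmul_eq_mul, ← hQdef]
      field_simp
    · have hu' : u ∈ G.neighborFinset x ∩ G.neighborFinset y := by
        have := mt mem_exclusiveNeighbors.2 h1
        simp at hu ⊢
        tauto
      rw [Finset.sum_congr rfl fun v _ => hinter v hu', Finset.sum_ite_eq,
        if_pos (Finset.mem_inter.1 hu').2]
  · rw [hmuy v (by simpa using hv), sum_neighborFinset_of_adj hadj,
      Finset.sum_congr rfl fun u hu => hinter v hu,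
      Finset.sum_congr (s₁ := exclusiveNeighbors G x y) rfl fun u hu => hexcl hu hv,
      Finset.sum_ite_eq', Finset.sum_const, nsmul_eq_mul, ← hPdef, mul_div_cancel₀ _ hP.ne',
      hself]
    have hv : G.Adj y v := by simpa using hv
    by_cases h1 : G.Adj x v
    · rw [hradj h1, if_neg (by simp [mem_exclusiveNeighbors, h1]), if_pos (by simp [hv, h1])]
      ring
    by_cases h2 : v = x
    · rw [h2, hrself]
      simp [mem_exclusiveNeighbors]
    have h3 := mem_exclusiveNeighbors.2 ⟨h2, hv, h1⟩
    rw [hresid h3, if_pos h3, if_neg (by simp [h1])]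
    ring
end
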